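/- Let d ≥ 1, d/2 < γ < (d+4)/2, M(v) = (1+|v|²)^{-γ/2}. Define P(g) := (∫ M²⟨v⟩^{-2} dv)^{-1} ∫ g M ⟨v⟩^{-2} dv. Then there is Λ > 0 such that for all g with ∫|∇_v(g/M)|²M² dv < ∞, Λ ∫_{ℝ^d} |g - P(g) M|² ⟨v⟩^{-2} dv ≤ ∫_{ℝ^d} |∇_v(g/M)|² M² dv. -/

import Mathlib

open MeasureTheory Real

noncomputable section

/-- Partial derivative of `f` in the `i`-th coordinate direction. -/
def pDeriv {d : ℕ} {G : Type*} [NormedAddCommGroup G] [NormedSpace ℝ G]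
    (f : EuclideanSpace ℝ (Fin d) → G) (i : Fin d) (v : EuclideanSpace ℝ (Fin d)) : G :=
  fderiv ℝ f v (EuclideanSpace.single i 1)

/-- one-dimensional estimate: squared increment is at most the integral of squared derivative -/
lemma aux_ftc (φ φ' : ℝ → ℝ) (h : ∀ t, HasDerivAt φ (φ' t) t) (hm : Measurable φ') :
    ENNReal.ofReal ((φ 1 - φ 0) ^ 2) ≤ ∫⁻ t in Set.Ioc (0:ℝ) 1, ENNReal.ofReal (φ' t ^ 2) := by
  by_cases hfin : ∫⁻ t in Set.Ioc (0:ℝ) 1, ENNReal.ofReal (φ' t ^ 2) = ⊤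
  · rw [hfin]; exact le_top
  have hsq : IntegrableOn (fun t => φ' t ^ 2) (Set.Ioc (0:ℝ) 1) := by
    refine ⟨(hm.pow_const 2).aestronglyMeasurable, ?_⟩
    rw [hasFiniteIntegral_iff_ofReal (Filter.Eventually.of_forall fun t => sq_nonneg _)]
    exact lt_top_iff_ne_top.2 hfin
  have hIntg : IntegrableOn φ' (Set.Ioc (0:ℝ) 1) := by
    have h1 : IntegrableOn (fun t => φ' t ^ 2 + 1) (Set.Ioc (0:ℝ) 1) :=
      hsq.add (integrableOn_const (by simp))
    refine Integrable.mono' h1 hm.aestronglyMeasurable (Filter.Eventually.of_forall fun t => ?_)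
    rw [Real.norm_eq_abs, abs_le]
    constructor <;> nlinarith [sq_nonneg (φ' t - 1), sq_nonneg (φ' t + 1)]
  have hI : ∫ t in (0:ℝ)..1, φ' t = φ 1 - φ 0 :=
    intervalIntegral.integral_eq_sub_of_hasDerivAt (fun t _ => h t)
      ((intervalIntegrable_iff_integrableOn_Ioc_of_le zero_le_one).2 hIntg)
  rw [intervalIntegral.integral_of_le zero_le_one] at hI
  rw [← ofReal_integral_eq_lintegral_ofReal hsq (Filter.Eventually.of_forall fun t => sq_nonneg _)]
  apply ENNReal.ofReal_le_ofReal
  set m := φ 1 - φ 0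
  have h0 : 0 ≤ ∫ t in Set.Ioc (0:ℝ) 1, (φ' t - m) ^ 2 := integral_nonneg fun t => sq_nonneg _
  have h2 : ∫ t in Set.Ioc (0:ℝ) 1, (φ' t - m) ^ 2
      = (∫ t in Set.Ioc (0:ℝ) 1, φ' t ^ 2) - 2 * m * (∫ t in Set.Ioc (0:ℝ) 1, φ' t) + m ^ 2 := by
    have e : (fun t => (φ' t - m) ^ 2) = fun t => (φ' t ^ 2 - 2 * m * φ' t) + m ^ 2 := by
      funext t; ring
    rw [e, integral_add, integral_sub, integral_const_mul]
    · simp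
    · exact hsq
    · exact hIntg.const_mul _
    · exact hsq.sub (hIntg.const_mul _)
    · exact integrableOn_const (by simp)
  rw [h2, hI] at h0
  nlinarith

lemma aux_cs {d : ℕ} (f : EuclideanSpace ℝ (Fin d) → ℝ) (v u : EuclideanSpace ℝ (Fin d)) :
    (fderiv ℝ f v u) ^ 2 ≤ ‖u‖ ^ 2 * ∑ i, (pDeriv f i v) ^ 2 := by
  have hu : fderiv ℝ f v u = ∑ i, u i * pDeriv f i v := by
    have : u = ∑ i, u i • EuclideanSpace.single i (1:ℝ) := by
      ext j
      simp [Finset.sum_apply, Pi.single_apply]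
    conv_lhs => rw [this]
    simp [map_sum, pDeriv]
  rw [hu, EuclideanSpace.norm_sq_eq]
  simpa using Finset.sum_mul_sq_le_sq_mul_sq Finset.univ (fun i => u i) (fun i => pDeriv f i v)

lemma aux_point {E : Type*} [NormedAddCommGroup E] [NormedSpace ℝ E] (γ : ℝ) (hγ : 0 < γ)
    (t : ℝ) (ht : 0 < t)
    (z u : E) (h : ‖z - t • u‖ < 1) :
    (1 + ‖u‖ ^ 2) ^ (-γ) ≤ (8:ℝ) ^ γ * (1 + ‖z‖ ^ 2) ^ (-γ) *
      (t ^ (2 * γ) + (1 + ‖u‖ ^ 2) ^ (-γ)) := by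
  have hz : ‖z‖ ≤ 1 + t * ‖u‖ := by
    calc ‖z‖ = ‖(z - t • u) + t • u‖ := by simp
      _ ≤ ‖z - t • u‖ + ‖t • u‖ := norm_add_le _ _
      _ ≤ 1 + t * ‖u‖ := by rw [norm_smul, Real.norm_of_nonneg ht.le]; linarith
  have hz2 : 1 + ‖z‖ ^ 2 ≤ 4 * (t ^ 2 * (1 + ‖u‖ ^ 2) + 1) := by
    have : ‖z‖ ^ 2 ≤ (1 + t * ‖u‖) ^ 2 := by gcongr
    nlinarith [sq_nonneg (1 - t * ‖u‖), sq_nonneg t, sq_nonneg (t * ‖u‖)]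
  have hU : 0 < 1 + ‖u‖ ^ 2 := by positivity
  have hZ : 0 < 1 + ‖z‖ ^ 2 := by positivity
  set U := 1 + ‖u‖ ^ 2
  set Z := 1 + ‖z‖ ^ 2
  have h3 : Z * U⁻¹ ≤ 8 * max (t ^ 2) U⁻¹ := by
    calc Z * U⁻¹ ≤ (4 * (t ^ 2 * U + 1)) * U⁻¹ := by gcongr
      _ = 4 * (t ^ 2 + U⁻¹) := by field_simp
      _ ≤ 8 * max (t ^ 2) U⁻¹ := by
        linarith [le_max_left (t ^ 2) U⁻¹, le_max_right (t ^ 2) U⁻¹]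
  have h4 : (Z * U⁻¹) ^ γ ≤ 8 ^ γ * (t ^ (2 * γ) + U ^ (-γ)) := by
    calc (Z * U⁻¹) ^ γ ≤ (8 * max (t ^ 2) U⁻¹) ^ γ := by gcongr
      _ = 8 ^ γ * (max (t ^ 2) U⁻¹) ^ γ := by
        rw [Real.mul_rpow (by norm_num) (by positivity)]
      _ ≤ 8 ^ γ * (t ^ (2 * γ) + U ^ (-γ)) := by
        gcongr
        have e1 : (t ^ 2) ^ γ = t ^ (2 * γ) := by
          rw [Real.rpow_mul ht.le]; norm_num
        have e2 : (U⁻¹) ^ γ = U ^ (-γ) := by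
          rw [Real.inv_rpow hU.le, Real.rpow_neg hU.le]
        have p1 : 0 ≤ t ^ (2 * γ) := by positivity
        have p2 : 0 ≤ U ^ (-γ) := by positivity
        rcases max_choice (t ^ 2) U⁻¹ with hh | hh <;> rw [hh]
        · rw [e1]; linarith
        · rw [e2]; linarith
  have h5 : (Z * U⁻¹) ^ γ = Z ^ γ * U ^ (-γ) := by
    rw [Real.mul_rpow hZ.le (by positivity), Real.inv_rpow hU.le, Real.rpow_neg hU.le]
  rw [h5] at h4
  have h6 : Z ^ (-γ) * Z ^ γ = 1 := by
    rw [← Real.rpow_add hZ]; simp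
  calc U ^ (-γ) = Z ^ (-γ) * (Z ^ γ * U ^ (-γ)) := by rw [← mul_assoc, h6, one_mul]
    _ ≤ Z ^ (-γ) * (8 ^ γ * (t ^ (2 * γ) + U ^ (-γ))) := by gcongr
    _ = _ := by ring

/-- the weight -/
def WW {d : ℕ} (s : ℝ) (v : EuclideanSpace ℝ (Fin d)) : ENNReal :=
  ENNReal.ofReal ((1 + ‖v‖ ^ 2) ^ (-s))

lemma WW_meas {d : ℕ} (s : ℝ) : Measurable (WW (d := d) s) := by
  unfold WW; fun_prop

lemma WW_fin {d : ℕ} (s : ℝ) (hs : (d:ℝ) / 2 < s) :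
    Integrable (fun v : EuclideanSpace ℝ (Fin d) => (1 + ‖v‖ ^ 2) ^ (-s)) := by
  have := integrable_rpow_neg_one_add_norm_sq (E := EuclideanSpace ℝ (Fin d)) (μ := volume)
    (r := 2 * s) (by simp; linarith)
  convert this using 3
  ring

lemma aux_kernel (d : ℕ) (γ : ℝ) (hγ : (d:ℝ) / 2 < γ) :
    ∃ C : NNReal, ∀ t : ℝ, 0 < t → t ≤ 1 → ∀ z : EuclideanSpace ℝ (Fin d),
      ∫⁻ u, (Metric.ball (0 : EuclideanSpace ℝ (Fin d)) 1).indicator 1 (z - t • u) * WW γ u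
        ≤ C * WW γ z := by
  have hγ0 : 0 < γ := lt_of_le_of_lt (by positivity) hγ
  set B := Metric.ball (0 : EuclideanSpace ℝ (Fin d)) 1
  have hI : ∫⁻ u : EuclideanSpace ℝ (Fin d), WW γ u ≠ ⊤ := by
    have := (WW_fin (d := d) γ hγ).lintegral_lt_top
    exact this.ne
  have hB : volume B ≠ ⊤ := measure_ball_lt_top.ne
  refine ⟨(ENNReal.ofReal (8 ^ γ) * (volume B + ∫⁻ u : EuclideanSpace ℝ (Fin d), WW γ u)).toNNReal,
    fun t ht ht1 z => ?_⟩
  rw [ENNReal.coe_toNNReal (by finiteness)]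
  have hset : ∀ u, B.indicator (1 : EuclideanSpace ℝ (Fin d) → ENNReal) (z - t • u)
      = (Metric.ball (t⁻¹ • z) t⁻¹).indicator 1 u := by
    intro u
    have : z - t • u ∈ B ↔ u ∈ Metric.ball (t⁻¹ • z) t⁻¹ := by
      have e : z - t • u = t • (t⁻¹ • z - u) := by
        rw [smul_sub, smul_smul, mul_inv_cancel₀ ht.ne', one_smul]
      rw [mem_ball_zero_iff, Metric.mem_ball, dist_comm, dist_eq_norm, e, norm_smul,
        Real.norm_of_nonneg ht.le, ← lt_inv_mul_iff₀ ht, mul_one]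
    by_cases hu : z - t • u ∈ B
    · rw [Set.indicator_of_mem hu, Set.indicator_of_mem (this.1 hu)]; rfl
    · rw [Set.indicator_of_notMem hu, Set.indicator_of_notMem (fun h => hu (this.2 h))]
  calc ∫⁻ u, B.indicator 1 (z - t • u) * WW γ u
      ≤ ∫⁻ u, ENNReal.ofReal (8 ^ γ) * WW γ z * (ENNReal.ofReal (t ^ (2 * γ)) *
          (Metric.ball (t⁻¹ • z) t⁻¹).indicator 1 u + WW γ u) := by
        apply lintegral_mono
        intro u
        dsimp only
        by_cases hu : z - t • u ∈ B
        · have h2 := hset u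
          rw [← h2, Set.indicator_of_mem hu]
          simp only [Pi.one_apply, one_mul, mul_one]
          unfold WW
          rw [← ENNReal.ofReal_add (by positivity) (by positivity),
            ← ENNReal.ofReal_mul (by positivity), ← ENNReal.ofReal_mul (by positivity)]
          exact ENNReal.ofReal_le_ofReal
            (aux_point γ hγ0 t ht z u (by simpa [B] using hu))
        · rw [Set.indicator_of_notMem hu]; simp
    _ = ENNReal.ofReal (8 ^ γ) * WW γ z * (ENNReal.ofReal (t ^ (2 * γ)) *
          volume (Metric.ball (t⁻¹ • z) t⁻¹) + ∫⁻ u : EuclideanSpace ℝ (Fin d), WW γ u) := by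
        have hm : Measurable ((Metric.ball (t⁻¹ • z) t⁻¹).indicator
            (1 : EuclideanSpace ℝ (Fin d) → ENNReal)) :=
          measurable_one.indicator measurableSet_ball
        have hw := WW_meas (d := d) γ
        rw [lintegral_const_mul _ (by fun_prop), lintegral_add_right _ hw,
          lintegral_const_mul _ hm, lintegral_indicator_one measurableSet_ball]
    _ ≤ ENNReal.ofReal (8 ^ γ) * WW γ z *
          (volume B + ∫⁻ u : EuclideanSpace ℝ (Fin d), WW γ u) := by
        gcongr
        rw [Measure.addHaar_ball_of_pos _ _ (by positivity), ← mul_assoc,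
          ← ENNReal.ofReal_mul (by positivity)]
        refine mul_le_of_le_one_left (by positivity) ?_
        rw [ENNReal.ofReal_le_one, finrank_euclideanSpace_fin, inv_pow, ← Real.rpow_natCast,
          ← Real.rpow_neg ht.le, ← Real.rpow_add ht]
        exact Real.rpow_le_one ht.le ht1 (by linarith)
    _ = _ := by ring

lemma aux_peetre (d : ℕ) (γ : ℝ) (hγ : 0 < γ) (y u : EuclideanSpace ℝ (Fin d))
    (hy : ‖y‖ < 1) :
    ENNReal.ofReal (‖u‖ ^ 2) * WW (γ + 1) (y + u) ≤ ENNReal.ofReal (4 ^ (γ + 1)) * WW γ u := by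
  unfold WW
  rw [← ENNReal.ofReal_mul (by positivity), ← ENNReal.ofReal_mul (by positivity)]
  apply ENNReal.ofReal_le_ofReal
  have h1 : ‖u‖ ≤ ‖y + u‖ + 1 := by
    calc ‖u‖ = ‖(y + u) - y‖ := by simp
      _ ≤ ‖y + u‖ + ‖y‖ := norm_sub_le _ _
      _ ≤ _ := by linarith
  have h2 : (1 + ‖u‖ ^ 2) ≤ 4 * (1 + ‖y + u‖ ^ 2) := by
    have : ‖u‖ ^ 2 ≤ (‖y + u‖ + 1) ^ 2 := by gcongr
    nlinarith [sq_nonneg (‖y + u‖ - 1)]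
  have hU : 0 < 1 + ‖u‖ ^ 2 := by positivity
  have hV : 0 < 1 + ‖y + u‖ ^ 2 := by positivity
  have h3 : (4 * (1 + ‖y + u‖ ^ 2)) ^ (-(γ + 1)) ≤ (1 + ‖u‖ ^ 2) ^ (-(γ + 1)) :=
    Real.rpow_le_rpow_of_nonpos hU h2 (by linarith)
  rw [Real.mul_rpow (by norm_num) hV.le, Real.rpow_neg (by norm_num)] at h3
  have h4 : (1 + ‖y + u‖ ^ 2) ^ (-(γ + 1)) ≤ 4 ^ (γ + 1) * (1 + ‖u‖ ^ 2) ^ (-(γ + 1)) := by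
    rwa [inv_mul_le_iff₀ (by positivity)] at h3
  have h5 : (1 + ‖u‖ ^ 2) * (1 + ‖u‖ ^ 2) ^ (-(γ + 1)) = (1 + ‖u‖ ^ 2) ^ (-γ) := by
    rw [show -γ = 1 + -(γ + 1) by ring, Real.rpow_add hU, Real.rpow_one]
  calc ‖u‖ ^ 2 * (1 + ‖y + u‖ ^ 2) ^ (-(γ + 1))
      ≤ (1 + ‖u‖ ^ 2) * (4 ^ (γ + 1) * (1 + ‖u‖ ^ 2) ^ (-(γ + 1))) := by
        gcongr; linarith
    _ = 4 ^ (γ + 1) * ((1 + ‖u‖ ^ 2) * (1 + ‖u‖ ^ 2) ^ (-(γ + 1))) := by ring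
    _ = _ := by rw [h5]

lemma aux_main (d : ℕ) (γ : ℝ) (hγ : (d:ℝ) / 2 < γ) :
    ∃ C : NNReal, ∀ f : EuclideanSpace ℝ (Fin d) → ℝ, Differentiable ℝ f →
      ∃ c : ℝ, ∫⁻ v, ENNReal.ofReal ((f v - c) ^ 2) * WW (γ + 1) v
        ≤ C * ∫⁻ v, ENNReal.ofReal (∑ i, (pDeriv f i v) ^ 2) * WW γ v := by
  have hγ0 : 0 < γ := lt_of_le_of_lt (by positivity) hγ
  obtain ⟨C, hC⟩ := aux_kernel d γ hγ
  set B := Metric.ball (0 : EuclideanSpace ℝ (Fin d)) 1 with hBdef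
  have hB : volume B ≠ ⊤ := measure_ball_lt_top.ne
  have hB0 : volume B ≠ 0 := (Metric.measure_ball_pos _ _ one_pos).ne'
  set K := ENNReal.ofReal (4 ^ (γ + 1)) with hK
  have hKt : K ≠ ⊤ := ENNReal.ofReal_ne_top
  have hBi : (volume B)⁻¹ ≠ ⊤ := ENNReal.inv_ne_top.2 hB0
  refine ⟨((volume B)⁻¹ * (K * C)).toNNReal, fun f hf => ?_⟩
  rw [ENNReal.coe_toNNReal (by finiteness)]
  set G : EuclideanSpace ℝ (Fin d) → ENNReal :=
    fun v => ENNReal.ofReal (∑ i, (pDeriv f i v) ^ 2) with hG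
  have hpm : ∀ i, Measurable (pDeriv f i) := fun i => measurable_fderiv_apply_const ℝ f _
  have hGm : Measurable G := by
    apply ENNReal.measurable_ofReal.comp
    exact Finset.measurable_sum _ fun i _ => (hpm i).pow_const 2
  have hfc : Measurable f := hf.continuous.measurable
  have hW := WW_meas (d := d) γ
  have hW1 := WW_meas (d := d) (γ + 1)
  have hind : Measurable (B.indicator (1 : EuclideanSpace ℝ (Fin d) → ENNReal)) :=
    measurable_one.indicator measurableSet_ball
  -- pointwise estimate
  have hinc : ∀ y u, ENNReal.ofReal ((f (y + u) - f y) ^ 2)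
      ≤ ENNReal.ofReal (‖u‖ ^ 2) * ∫⁻ t in Set.Ioc (0:ℝ) 1, G (y + t • u) := by
    intro y u
    have hd : ∀ t : ℝ, HasDerivAt (fun t : ℝ => f (y + t • u)) (fderiv ℝ f (y + t • u) u) t := by
      intro t
      have h1 : HasDerivAt (fun t : ℝ => y + t • u) u t := by
        simpa using ((hasDerivAt_id t).smul_const u).const_add y
      exact (hf (y + t • u)).hasFDerivAt.comp_hasDerivAt t h1
    have hm : Measurable (fun t : ℝ => fderiv ℝ f (y + t • u) u) :=
      (measurable_fderiv_apply_const ℝ f u).comp (by fun_prop)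
    have := aux_ftc _ _ hd hm
    simp only [one_smul, zero_smul, add_zero] at this
    refine this.trans ?_
    rw [← lintegral_const_mul _ (by fun_prop)]
    apply lintegral_mono
    intro t
    dsimp only [hG]
    rw [← ENNReal.ofReal_mul (by positivity)]
    exact ENNReal.ofReal_le_ofReal (aux_cs f _ u)
  -- the averaged estimate
  have havg : ∫⁻ y in B, ∫⁻ v, ENNReal.ofReal ((f v - f y) ^ 2) * WW (γ + 1) v
      ≤ K * C * ∫⁻ v, G v * WW γ v := by
    calc ∫⁻ y in B, ∫⁻ v, ENNReal.ofReal ((f v - f y) ^ 2) * WW (γ + 1) v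
        = ∫⁻ y in B, ∫⁻ u, ENNReal.ofReal ((f (y + u) - f y) ^ 2) * WW (γ + 1) (y + u) := by
          congr 1; funext y
          exact (lintegral_add_left_eq_self
            (fun v => ENNReal.ofReal ((f v - f y) ^ 2) * WW (γ + 1) v) y).symm
      _ ≤ ∫⁻ y in B, ∫⁻ u, K * WW γ u * ∫⁻ t in Set.Ioc (0:ℝ) 1, G (y + t • u) := by
          apply setLIntegral_mono' measurableSet_ball
          intro y hy
          apply lintegral_mono
          intro u
          calc _ ≤ (ENNReal.ofReal (‖u‖ ^ 2) * ∫⁻ t in Set.Ioc (0:ℝ) 1, G (y + t • u))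
                * WW (γ + 1) (y + u) := mul_le_mul_left (hinc y u) _
            _ = (ENNReal.ofReal (‖u‖ ^ 2) * WW (γ + 1) (y + u))
                * ∫⁻ t in Set.Ioc (0:ℝ) 1, G (y + t • u) := by ring
            _ ≤ _ := 
              mul_le_mul_left (aux_peetre d γ hγ0 y u (by simpa [hBdef] using hy)) _
      _ = ∫⁻ y in B, ∫⁻ u, ∫⁻ t in Set.Ioc (0:ℝ) 1, K * WW γ u * G (y + t • u) := by
          congr 1; funext y; congr 1; funext u
          rw [lintegral_const_mul _ (by fun_prop)]
      _ = ∫⁻ y in B, ∫⁻ t in Set.Ioc (0:ℝ) 1, ∫⁻ u, K * WW γ u * G (y + t • u) := by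
          congr 1; funext y
          exact lintegral_lintegral_swap (by fun_prop)
      _ = ∫⁻ t in Set.Ioc (0:ℝ) 1, ∫⁻ y in B, ∫⁻ u, K * WW γ u * G (y + t • u) := by
          refine lintegral_lintegral_swap ?_
          apply Measurable.aemeasurable
          apply Measurable.lintegral_prod_right'
            (f := fun p : (EuclideanSpace ℝ (Fin d) × ℝ) × EuclideanSpace ℝ (Fin d) =>
              K * WW γ p.2 * G (p.1.1 + p.1.2 • p.2))
          fun_prop
      _ ≤ ∫⁻ t in Set.Ioc (0:ℝ) 1, K * C * ∫⁻ v, G v * WW γ v := by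
          apply setLIntegral_mono' measurableSet_Ioc
          intro t ht
          calc ∫⁻ y in B, ∫⁻ u, K * WW γ u * G (y + t • u)
              = ∫⁻ u, ∫⁻ y in B, K * WW γ u * G (y + t • u) :=
                lintegral_lintegral_swap (by fun_prop)
            _ = ∫⁻ u, ∫⁻ z, K * WW γ u * (B.indicator 1 (z - t • u) * G z) := by
                congr 1; funext u
                rw [← lintegral_indicator measurableSet_ball,
                  ← lintegral_add_right_eq_self
                    (fun z => K * WW γ u * (B.indicator 1 (z - t • u) * G z)) (t • u)]
                congr 1; funext y
                rw [add_sub_cancel_right]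
                by_cases hy : y ∈ B
                · rw [Set.indicator_of_mem hy, Set.indicator_of_mem hy]; simp
                · rw [Set.indicator_of_notMem hy, Set.indicator_of_notMem hy]; simp
            _ = ∫⁻ z, ∫⁻ u, K * WW γ u * (B.indicator 1 (z - t • u) * G z) :=
                lintegral_lintegral_swap (by fun_prop)
            _ = ∫⁻ z, K * G z * ∫⁻ u, B.indicator 1 (z - t • u) * WW γ u := by
                congr 1; funext z
                rw [← lintegral_const_mul _ (by fun_prop)]
                congr 1; funext u; ring
            _ ≤ ∫⁻ z, K * G z * (C * WW γ z) := by
                apply lintegral_mono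
                intro z
                dsimp only
                gcongr
                exact hC t ht.1 ht.2 z
            _ = K * C * ∫⁻ v, G v * WW γ v := by
                rw [← lintegral_const_mul _ (by fun_prop)]
                congr 1; funext u; ring
      _ = K * C * ∫⁻ v, G v * WW γ v := by simp
  obtain ⟨y, -, hy⟩ := exists_le_setLAverage (μ := volume) (s := B)
    (f := fun y => ∫⁻ v, ENNReal.ofReal ((f v - f y) ^ 2) * WW (γ + 1) v) hB0 hB (by
      apply Measurable.aemeasurable
      apply Measurable.lintegral_prod_right'
        (f := fun p : EuclideanSpace ℝ (Fin d) × EuclideanSpace ℝ (Fin d) =>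
              ENNReal.ofReal ((f p.2 - f p.1) ^ 2) * WW (γ + 1) p.2)
      fun_prop)
  refine ⟨f y, hy.trans ?_⟩
  rw [setLAverage_eq, ENNReal.div_eq_inv_mul, mul_assoc]
  gcongr

theorem stmt6 (d : ℕ) (hd : 1 ≤ d) (γ : ℝ)
    (h1 : (d : ℝ) / 2 < γ) (h2 : γ < ((d : ℝ) + 4) / 2)
    (M : EuclideanSpace ℝ (Fin d) → ℝ)
    (hM : ∀ v, M v = (1 + ‖v‖ ^ 2) ^ (-(γ / 2))) :
    ∃ Λ : ℝ, 0 < Λ ∧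
      ∀ g : EuclideanSpace ℝ (Fin d) → ℝ, Differentiable ℝ g →
        Integrable (fun v => (∑ i, (pDeriv (fun w => g w / M w) i v) ^ 2) * (M v) ^ 2) →
        Integrable (fun v => g v ^ 2 / (1 + ‖v‖ ^ 2)) →
        Integrable (fun v => g v * M v / (1 + ‖v‖ ^ 2)) →
        Λ * ∫ v, (g v
              - ((∫ w, (M w) ^ 2 / (1 + ‖w‖ ^ 2))⁻¹ * ∫ w, g w * M w / (1 + ‖w‖ ^ 2))
                * M v) ^ 2 / (1 + ‖v‖ ^ 2)
          ≤ ∫ v, (∑ i, (pDeriv (fun w => g w / M w) i v) ^ 2) * (M v) ^ 2 := by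
  obtain ⟨C, hC⟩ := aux_main d γ h1
  have hMpos : ∀ v, 0 < M v := fun v => by rw [hM]; positivity
  have hM2 : ∀ v, M v ^ 2 = (1 + ‖v‖ ^ 2) ^ (-γ) := fun v => by
    rw [hM, ← Real.rpow_natCast, ← Real.rpow_mul (by positivity)]
    congr 1; push_cast; ring
  have hM3 : ∀ v, M v ^ 2 / (1 + ‖v‖ ^ 2) = (1 + ‖v‖ ^ 2) ^ (-(γ + 1)) := fun v => by
    rw [hM2, show -(γ + 1) = -γ - 1 by ring, Real.rpow_sub_one (by positivity)]
  have hMint : Integrable (fun v => M v ^ 2 / (1 + ‖v‖ ^ 2)) := by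
    simp only [hM3]; exact WW_fin (γ + 1) (by linarith)
  have hMd : Differentiable ℝ M := by
    have : M = fun v => (1 + ‖v‖ ^ 2) ^ (-(γ / 2)) := funext hM
    rw [this]
    refine Differentiable.rpow_const ?_ ?_
    · exact (differentiable_id.norm_sq ℝ).const_add 1
    · intro x; left; positivity
  refine ⟨((C:ℝ) + 1)⁻¹, by positivity, fun g hg hi1 hi2 hi3 => ?_⟩
  obtain ⟨c, hc⟩ := hC (fun w => g w / M w) (fun v => by
    simpa only [div_eq_mul_inv] using (hg v).fun_mul ((hMd v).fun_inv (hMpos v).ne'))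
  set A := ∫ w, (M w) ^ 2 / (1 + ‖w‖ ^ 2) with hA
  set Bb := ∫ w, g w * M w / (1 + ‖w‖ ^ 2) with hBb
  set R := ∫ v, (∑ i, (pDeriv (fun w => g w / M w) i v) ^ 2) * (M v) ^ 2 with hR
  have hexp : ∀ m : ℝ, (fun v => (g v - m * M v) ^ 2 / (1 + ‖v‖ ^ 2)) =
      fun v => (g v ^ 2 / (1 + ‖v‖ ^ 2) - 2 * m * (g v * M v / (1 + ‖v‖ ^ 2)))
        + m ^ 2 * (M v ^ 2 / (1 + ‖v‖ ^ 2)) := by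
    intro m; funext v; ring
  have hIntg : ∀ m : ℝ, Integrable (fun v => (g v - m * M v) ^ 2 / (1 + ‖v‖ ^ 2)) := by
    intro m; rw [hexp]
    exact (hi2.sub (hi3.const_mul _)).add (hMint.const_mul _)
  have hval : ∀ m : ℝ, ∫ v, (g v - m * M v) ^ 2 / (1 + ‖v‖ ^ 2) =
      (∫ v, g v ^ 2 / (1 + ‖v‖ ^ 2)) - 2 * m * Bb + m ^ 2 * A := by
    intro m
    rw [hexp, integral_add, integral_sub hi2 (hi3.const_mul _), integral_const_mul,
      integral_const_mul]
    · exact hi2.sub (hi3.const_mul _)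
    · exact hMint.const_mul _
  have hApos : 0 < A := by
    rw [hA, integral_pos_iff_support_of_nonneg (fun v => by positivity) hMint]
    have : Function.support (fun w => M w ^ 2 / (1 + ‖w‖ ^ 2)) = Set.univ := by
      ext v
      simp only [Function.mem_support, Set.mem_univ, iff_true]
      have := hMpos v
      positivity
    rw [this]
    exact Measure.measure_univ_pos.2 (NeZero.ne _)
  have hmin : ∫ v, (g v - (A⁻¹ * Bb) * M v) ^ 2 / (1 + ‖v‖ ^ 2)
      ≤ ∫ v, (g v - c * M v) ^ 2 / (1 + ‖v‖ ^ 2) := by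
    rw [hval, hval]
    have hb : Bb = A * (A⁻¹ * Bb) := by field_simp
    set m := A⁻¹ * Bb
    rw [hb]
    nlinarith [mul_nonneg hApos.le (sq_nonneg (c - m))]
  have hRnn : 0 ≤ R := integral_nonneg fun v => by positivity
  have hcR : ∫ v, (g v - c * M v) ^ 2 / (1 + ‖v‖ ^ 2) ≤ C * R := by
    have e1 : ∫⁻ v, ENNReal.ofReal ((g v / M v - c) ^ 2) * WW (γ + 1) v
        = ENNReal.ofReal (∫ v, (g v - c * M v) ^ 2 / (1 + ‖v‖ ^ 2)) := by
      rw [ofReal_integral_eq_lintegral_ofReal (hIntg c)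
        (Filter.Eventually.of_forall fun v => by positivity)]
      congr 1; funext v
      unfold WW
      rw [← ENNReal.ofReal_mul (by positivity), ← hM3]
      congr 1
      have := (hMpos v).ne'
      field_simp
    have e2 : ∫⁻ v, ENNReal.ofReal (∑ i, (pDeriv (fun w => g w / M w) i v) ^ 2) * WW γ v
        = ENNReal.ofReal R := by
      rw [hR, ofReal_integral_eq_lintegral_ofReal hi1
        (Filter.Eventually.of_forall fun v => by positivity)]
      congr 1; funext v
      unfold WW
      rw [← ENNReal.ofReal_mul (by positivity), ← hM2]
    rw [e1, e2, ← ENNReal.ofReal_coe_nnreal, ← ENNReal.ofReal_mul (by positivity)] at hc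
    exact (ENNReal.ofReal_le_ofReal_iff (by positivity)).1 hc
  rw [inv_mul_le_iff₀ (by positivity)]
  nlinarith

end
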